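/- arXiv:1910.02432 — 8 statements merged into one kernel-verified Lean document; each statement's English description precedes it below -/
import Mathlib

section
/- Let K be a compact convex subset of ℝⁿ (n ≥ 2) whose affine span has dimension at least 2, let O be a boundary point of K, and let r > 0. If the intersection of the sphere of radius r centered at O with K is not connected (not preconnected), then there exists an O-critical point P of K with dist(O, P) ≤ r. (Equivalently, the connectivity radius of O is at least the least critical distance of O.) -/
open scoped RealInnerProductSpace

/-- `P` is an `O`-critical point of a convex set `K`: a boundary point distinct from `O` such
that the affine hyperplane through `P` orthogonal to `OP` supports `K`. -/
def IsCriticalPoint {n : ℕ} (K : Set (EuclideanSpace ℝ (Fin n)))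
    (O P : EuclideanSpace ℝ (Fin n)) : Prop :=
  P ∈ frontier K ∧ P ≠ O ∧ ∀ X ∈ K, 0 ≤ ⟪O - P, X - P⟫

section OutwardDeformation

variable {E : Type*} [NormedAddCommGroup E] [InnerProductSpace ℝ E]

/-- If no point of `K` in a closed annulus around `O` is `O`-critical, then `K` admits a continuous
choice of target points on this annulus whose direction is uniformly outward. -/
theorem exists_continuousOn_outward_target {K : Set E} (hK : IsCompact K) (hKc : Convex ℝ K)
    {O : E} {δ R : ℝ}
    (h : ∀ P ∈ K, δ ≤ ‖P - O‖ ^ 2 → ‖P - O‖ ^ 2 ≤ R → ∃ X ∈ K, 0 < ⟪P - O, X - P⟫) :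
    ∃ c > 0, ∃ X : E → E, ContinuousOn X {P ∈ K | δ ≤ ‖P - O‖ ^ 2 ∧ ‖P - O‖ ^ 2 ≤ R} ∧
      ∀ P ∈ K, δ ≤ ‖P - O‖ ^ 2 → ‖P - O‖ ^ 2 ≤ R → X P ∈ K ∧ c ≤ ⟪P - O, X P - P⟫ := by
  classical
  set Z : Set E := {P ∈ K | δ ≤ ‖P - O‖ ^ 2 ∧ ‖P - O‖ ^ 2 ≤ R} with hZ
  have hZc : IsCompact Z := by
    have hcont : Continuous fun P : E => ‖P - O‖ ^ 2 := by fun_prop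
    exact hK.inter_right ((isClosed_le continuous_const hcont).inter
      (isClosed_le hcont continuous_const))
  obtain ⟨g, hg⟩ := exists_continuous_forall_mem_convex_of_local_const
    (X := Z) (E := E) (t := fun P => {X ∈ K | 0 < ⟪(P : E) - O, X - P⟫})
    (fun P => by
      refine hKc.inter (t := {X : E | 0 < ⟪(P : E) - O, X - P⟫}) ?_
      have : {X : E | 0 < ⟪(P : E) - O, X - P⟫}
          = {X : E | ⟪(P : E) - O, (P : E)⟫ < innerₛₗ ℝ ((P : E) - O) X} := by
        ext X
        simp only [Set.mem_ofPred_eq, inner_sub_right, innerₛₗ_apply_apply, sub_pos]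
      rw [this]
      exact convex_halfSpace_gt (innerₛₗ ℝ ((P : E) - O)).isLinear _)
    (fun P => by
      obtain ⟨X, hX, hpos⟩ := h P P.2.1 P.2.2.1 P.2.2.2
      refine ⟨X, ?_⟩
      have : ContinuousAt (fun Q : Z => ⟪(Q : E) - O, X - Q⟫) P := by fun_prop
      filter_upwards [this.eventually (lt_mem_nhds hpos)] with Q hQ using ⟨hX, hQ⟩)
  have hX : ∀ P (hP : P ∈ Z), (if h : P ∈ Z then g ⟨P, h⟩ else O) = g ⟨P, hP⟩ :=
    fun P hP => dif_pos hP
  have hcont : ContinuousOn (fun P => if h : P ∈ Z then g ⟨P, h⟩ else O) Z := by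
    rw [continuousOn_iff_continuous_domRestrict]
    convert g.continuous using 1
    ext P
    exact hX P P.2
  obtain ⟨c, hc, hcb⟩ : ∃ c > 0, ∀ P : Z, c ≤ ⟪(P : E) - O, g P - P⟫ := by
    have := isCompact_iff_compactSpace.mp hZc
    rcases isEmpty_or_nonempty Z with hempty | hne
    · exact ⟨1, one_pos, fun P => hempty.elim P⟩
    · obtain ⟨P, -, hP⟩ := isCompact_univ.exists_isMinOn Set.univ_nonempty
        (f := fun P : Z => ⟪(P : E) - O, g P - P⟫) (by fun_prop)
      exact ⟨_, (hg P).2, fun Q => hP (Set.mem_univ Q)⟩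
  refine ⟨c, hc, _, hcont, fun P hP h₁ h₂ => ?_⟩
  rw [hX P ⟨hP, h₁, h₂⟩]
  exact ⟨(hg _).1, hcb ⟨P, hP, h₁, h₂⟩⟩

/-- The positive root of `a t ^ 2 + 2 b t = d`, in a form continuous at `a = 0`. -/
theorem quadratic_outward_root {a b c d : ℝ} (ha : 0 ≤ a) (hc : 0 < c) (hb : c ≤ b) (hd : 0 ≤ d)
    (hdc : d ≤ 2 * c) :
    0 < b + √(b ^ 2 + d * a) ∧ 0 ≤ d / (b + √(b ^ 2 + d * a)) ∧
      d / (b + √(b ^ 2 + d * a)) ≤ 1 ∧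
      a * (d / (b + √(b ^ 2 + d * a))) ^ 2 + 2 * b * (d / (b + √(b ^ 2 + d * a))) = d := by
  have hda : 0 ≤ d * a := mul_nonneg hd ha
  have hs : b ≤ √(b ^ 2 + d * a) := Real.le_sqrt_of_sq_le (by linarith)
  have hsq : √(b ^ 2 + d * a) ^ 2 = b ^ 2 + d * a := Real.sq_sqrt (by positivity)
  set s := √(b ^ 2 + d * a)
  have hpos : 0 < b + s := by linarith
  refine ⟨hpos, by positivity, (div_le_one hpos).2 (by linarith), ?_⟩
  field_simp
  linear_combination (-d) * hsq

/-- Pushing a preconnected subset of `K` outward by a small amount, keeping its outer points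
fixed. -/
theorem exists_isPreconnected_push_outward {K : Set E} (hKc : Convex ℝ K)
    {O x y : E} {δ R c q q' : ℝ} (hc : 0 < c) {X : E → E}
    (hXc : ContinuousOn X {P ∈ K | δ ≤ ‖P - O‖ ^ 2 ∧ ‖P - O‖ ^ 2 ≤ R})
    (hX : ∀ P ∈ K, δ ≤ ‖P - O‖ ^ 2 → ‖P - O‖ ^ 2 ≤ R → X P ∈ K ∧ c ≤ ⟪P - O, X P - P⟫)
    (hδq : δ ≤ q) (hqc : q' ≤ q + 2 * c) (hqR : q' ≤ R)
    (hx : ‖x - O‖ ^ 2 = R) (hy : ‖y - O‖ ^ 2 = R)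
    (hT : ∃ T ⊆ {P ∈ K | q ≤ ‖P - O‖ ^ 2 ∧ ‖P - O‖ ^ 2 ≤ R}, x ∈ T ∧ y ∈ T ∧ IsPreconnected T) :
    ∃ T ⊆ {P ∈ K | q' ≤ ‖P - O‖ ^ 2 ∧ ‖P - O‖ ^ 2 ≤ R}, x ∈ T ∧ y ∈ T ∧ IsPreconnected T := by
  obtain ⟨T, hTZ, hxT, hyT, hTc⟩ := hT
  have hTδ : T ⊆ {P ∈ K | δ ≤ ‖P - O‖ ^ 2 ∧ ‖P - O‖ ^ 2 ≤ R} :=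
    fun P hP => ⟨(hTZ hP).1, hδq.trans (hTZ hP).2.1, (hTZ hP).2.2⟩
  let d : E → ℝ := fun P => max (q' - ‖P - O‖ ^ 2) 0
  let b : E → ℝ := fun P => ⟪P - O, X P - P⟫
  let τ : E → ℝ := fun P => d P / (b P + √(b P ^ 2 + d P * ‖X P - P‖ ^ 2))
  have hroot : ∀ P ∈ T, 0 < b P + √(b P ^ 2 + d P * ‖X P - P‖ ^ 2) ∧ 0 ≤ τ P ∧ τ P ≤ 1 ∧
      ‖X P - P‖ ^ 2 * τ P ^ 2 + 2 * b P * τ P = d P := fun P hP => by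
    obtain ⟨hPK, hP₁, hP₂⟩ := hTδ hP
    exact quadratic_outward_root (sq_nonneg _) hc (hX P hPK hP₁ hP₂).2 (le_max_right _ _)
      (max_le (by linarith [(hTZ hP).2.1]) (by linarith))
  have hτ : ∀ P, R ≤ ‖P - O‖ ^ 2 → τ P = 0 := fun P hP => by
    have : d P = 0 := max_eq_right (by linarith)
    simp [τ, this]
  have hXT : ContinuousOn X T := hXc.mono hTδ
  have hcont : ContinuousOn (fun P => P + τ P • (X P - P)) T := by
    have hd : ContinuousOn d T := by fun_prop
    have hb : ContinuousOn b T := by fun_prop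
    have hτc : ContinuousOn τ T :=
      ContinuousOn.div hd (by fun_prop) fun P hP => (hroot P hP).1.ne'
    fun_prop
  refine ⟨(fun P => P + τ P • (X P - P)) '' T, ?_, ⟨x, hxT, ?_⟩, ⟨y, hyT, ?_⟩, hTc.image _ hcont⟩
  · rintro _ ⟨P, hP, rfl⟩
    obtain ⟨hPK, hP₁, hP₂⟩ := hTδ hP
    obtain ⟨-, h0, h1, heq⟩ := hroot P hP
    have hnorm : ‖P + τ P • (X P - P) - O‖ ^ 2 = ‖P - O‖ ^ 2 + d P := by
      rw [add_sub_right_comm, norm_add_sq_real, real_inner_smul_right, norm_smul, mul_pow,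
        Real.norm_eq_abs, sq_abs, ← heq]
      ring
    refine ⟨hKc.add_smul_sub_mem hPK (hX P hPK hP₁ hP₂).1 ⟨h0, h1⟩, ?_, ?_⟩
    · rw [hnorm]
      linarith [le_max_left (q' - ‖P - O‖ ^ 2) 0]
    · rw [hnorm]
      rcases max_cases (q' - ‖P - O‖ ^ 2) 0 with h | h <;> simp only [d, h.1] <;> linarith
  · simp [hτ x hx.ge]
  · simp [hτ y hy.ge]

theorem exists_isPreconnected_subset_sphere {K : Set E} (hK : IsCompact K) (hKc : Convex ℝ K)
    {O x y : E} {δ R : ℝ} (hδR : δ ≤ R)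
    (h : ∀ P ∈ K, δ ≤ ‖P - O‖ ^ 2 → ‖P - O‖ ^ 2 ≤ R → ∃ X ∈ K, 0 < ⟪P - O, X - P⟫)
    (hx : ‖x - O‖ ^ 2 = R) (hy : ‖y - O‖ ^ 2 = R)
    (hT : ∃ T ⊆ {P ∈ K | δ ≤ ‖P - O‖ ^ 2 ∧ ‖P - O‖ ^ 2 ≤ R}, x ∈ T ∧ y ∈ T ∧ IsPreconnected T) :
    ∃ T ⊆ {P ∈ K | ‖P - O‖ ^ 2 = R}, x ∈ T ∧ y ∈ T ∧ IsPreconnected T := by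
  obtain ⟨c, hc, X, hXc, hX⟩ := exists_continuousOn_outward_target hK hKc h
  have key : ∀ m : ℕ, ∃ T ⊆ {P ∈ K | min (δ + m * (2 * c)) R ≤ ‖P - O‖ ^ 2 ∧ ‖P - O‖ ^ 2 ≤ R},
      x ∈ T ∧ y ∈ T ∧ IsPreconnected T := by
    intro m
    induction m with
    | zero => simpa [hδR] using hT
    | succ m ih =>
      refine exists_isPreconnected_push_outward hKc hc hXc hX ?_ ?_ (min_le_right _ _) hx hy ih
      · exact le_min (by have : 0 ≤ m * (2 * c) := by positivity
                         linarith) hδR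
      · rw [← min_add_add_right]
        push_cast
        exact min_le_min (by linarith) (by linarith)
  obtain ⟨m, hm⟩ := exists_nat_ge ((R - δ) / (2 * c))
  rw [div_le_iff₀ (by positivity)] at hm
  obtain ⟨T, hTZ, hT⟩ := key m
  refine ⟨T, fun P hP => ⟨(hTZ hP).1, le_antisymm (hTZ hP).2.2 ?_⟩, hT⟩
  simpa [min_eq_right (show R ≤ δ + m * (2 * c) by linarith)] using (hTZ hP).2.1

/-- Two points of a convex set of dimension at least two lying on a sphere around `O` can be joined
by a compact preconnected subset of the ball avoiding `O`. -/
theorem exists_isPreconnected_joining_notMem {K : Set E} (hKc : Convex ℝ K)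
    (hdim : 2 ≤ Module.finrank ℝ (vectorSpan ℝ K)) {O x y : E} {r : ℝ} (hr : 0 < r)
    (hO : O ∈ K) (hxK : x ∈ K) (hyK : y ∈ K) (hx : ‖x - O‖ = r) (hy : ‖y - O‖ = r) :
    ∃ T ⊆ K ∩ Metric.closedBall O r, IsCompact T ∧ O ∉ T ∧ x ∈ T ∧ y ∈ T ∧ IsPreconnected T := by
  have hconv : Convex ℝ (K ∩ Metric.closedBall O r) := hKc.inter (convex_closedBall O r)
  have hcpt : ∀ u v : E, IsCompact (segment ℝ u v) := fun u v => by
    rw [segment_eq_image_lineMap]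
    exact isCompact_Icc.image (by fun_prop)
  have hxB : x ∈ K ∩ Metric.closedBall O r := ⟨hxK, by simp [dist_eq_norm, hx]⟩
  have hyB : y ∈ K ∩ Metric.closedBall O r := ⟨hyK, by simp [dist_eq_norm, hy]⟩
  by_cases hOxy : O ∈ segment ℝ x y
  · have hx0 : x - O ≠ 0 := norm_pos_iff.1 (hx ▸ hr)
    have hy0 : y - O ≠ 0 := norm_pos_iff.1 (hy ▸ hr)
    have hspan : ∀ u v : E, u - O ≠ 0 → O ∈ segment ℝ u v → v - O ∈ ℝ ∙ (u - O) := by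
      rintro u v hu ⟨a, b, ha, hb, hab, heq⟩
      have hsum : a • (u - O) + b • (v - O) = 0 := by
        rw [smul_sub, smul_sub, sub_add_sub_comm, heq, ← add_smul, hab, one_smul, sub_self]
      have hb0 : b ≠ 0 := by
        rintro rfl
        rw [add_zero] at hab
        simp [hab, hu] at hsum
      refine Submodule.mem_span_singleton.2 ⟨-(b⁻¹ * a), ?_⟩
      have := congrArg (b⁻¹ • ·) hsum
      simp only [smul_add, smul_smul, inv_mul_cancel₀ hb0, one_smul, smul_zero] at this
      rw [neg_smul]
      exact (eq_neg_of_add_eq_zero_right this).symm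
    obtain ⟨z, hzK, hz⟩ : ∃ z ∈ K, z - O ∉ ℝ ∙ (x - O) := by
      by_contra! hcon
      have hle : vectorSpan ℝ K ≤ ℝ ∙ (x - O) := by
        rw [vectorSpan_eq_span_vsub_set_right ℝ hO, Submodule.span_le]
        rintro _ ⟨z, hz, rfl⟩
        exact hcon z hz
      have := Submodule.finrank_mono hle
      rw [finrank_span_singleton hx0] at this
      omega
    have hz0 : 0 < ‖z - O‖ := norm_pos_iff.2 fun h => hz (h ▸ zero_mem _)
    have hε : 0 < min 1 (r / ‖z - O‖) := by positivity
    set ε := min 1 (r / ‖z - O‖) with hεdef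
    set w := O + ε • (z - O) with hw
    have hwO : w - O = ε • (z - O) := add_sub_cancel_left _ _
    have hwB : w ∈ K ∩ Metric.closedBall O r := by
      refine ⟨hKc.add_smul_sub_mem hO hzK ⟨hε.le, min_le_left _ _⟩, ?_⟩
      rw [mem_closedBall_iff_norm, hwO, norm_smul, Real.norm_of_nonneg hε.le]
      exact (le_div_iff₀ hz0).1 (min_le_right _ _)
    have hwspan : w - O ∉ ℝ ∙ (x - O) := by
      rwa [hwO, Submodule.smul_mem_iff _ hε.ne']
    have hspan_le : (ℝ ∙ (y - O)) ≤ ℝ ∙ (x - O) := by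
      rw [Submodule.span_singleton_le_iff_mem]
      exact hspan x y hx0 hOxy
    refine ⟨segment ℝ x w ∪ segment ℝ y w, ?_, (hcpt _ _).union (hcpt _ _), ?_,
      Or.inl (left_mem_segment ..), Or.inr (left_mem_segment ..), ?_⟩
    · exact Set.union_subset (hconv.segment_subset hxB hwB) (hconv.segment_subset hyB hwB)
    · rintro (h | h)
      · exact hwspan (hspan x w hx0 h)
      · exact hwspan (hspan_le (hspan y w hy0 h))
    · exact IsPreconnected.union w (right_mem_segment ..) (right_mem_segment ..)
        (convex_segment _ _).isPreconnected (convex_segment _ _).isPreconnected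
  · exact ⟨segment ℝ x y, hconv.segment_subset hxB hyB, hcpt _ _, hOxy, left_mem_segment ..,
      right_mem_segment .., (convex_segment _ _).isPreconnected⟩

/-- A sphere around a point of a compact convex set of dimension at least two meets the set in a
preconnected set, provided that the distance to the centre can be increased to first order within
the set at each of its points in the punctured ball. -/
theorem isPreconnected_sphere_inter_of_outward {K : Set E} (hK : IsCompact K) (hKc : Convex ℝ K)
    (hdim : 2 ≤ Module.finrank ℝ (vectorSpan ℝ K)) {O : E} (hO : O ∈ K) {r : ℝ} (hr : 0 < r)
    (h : ∀ P ∈ K, P ≠ O → ‖P - O‖ ≤ r → ∃ X ∈ K, 0 < ⟪P - O, X - P⟫) :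
    IsPreconnected (Metric.sphere O r ∩ K) := by
  refine isPreconnected_of_forall_pair fun x hx y hy => ?_
  have hxr := mem_sphere_iff_norm.1 hx.1
  have hyr := mem_sphere_iff_norm.1 hy.1
  obtain ⟨T, hTK, hTcpt, hOT, hxT, hyT, hTc⟩ :=
    exists_isPreconnected_joining_notMem hKc hdim hr hO hx.2 hy.2 hxr hyr
  obtain ⟨P, hPT, hPmin⟩ := hTcpt.exists_isMinOn ⟨x, hxT⟩
    (f := fun P => ‖P - O‖ ^ 2) (by fun_prop)
  have hP0 : 0 < ‖P - O‖ ^ 2 :=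
    pow_pos (norm_pos_iff.2 (sub_ne_zero.2 (ne_of_mem_of_not_mem hPT hOT))) 2
  have hTr : ∀ Q ∈ T, ‖Q - O‖ ^ 2 ≤ r ^ 2 := fun Q hQ =>
    pow_le_pow_left₀ (norm_nonneg _) (mem_closedBall_iff_norm.1 (hTK hQ).2) 2
  obtain ⟨S, hS, hxS, hyS, hSc⟩ := exists_isPreconnected_subset_sphere hK hKc (O := O) (x := x)
    (y := y) (hTr P hPT)
    (fun Q hQ h₁ h₂ => h Q hQ (by rintro rfl; simp at h₁; simp [h₁] at hP0)
      ((sq_le_sq₀ (norm_nonneg _) hr.le).1 h₂))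
    (by rw [hxr]) (by rw [hyr]) ⟨T, fun Q hQ => ⟨(hTK hQ).1, hPmin hQ, hTr Q hQ⟩, hxT, hyT, hTc⟩
  refine ⟨S, fun Q hQ => ⟨mem_sphere_iff_norm.2 ?_, (hS hQ).1⟩, hxS, hyS, hSc⟩
  exact (sq_eq_sq₀ (norm_nonneg _) hr.le).1 (hS hQ).2

/-- A point of `K` at which a closed half-space with outer normal `P - O ≠ 0` supports `K` lies on
the frontier of `K`. -/
theorem mem_frontier_of_forall_inner_nonneg {K : Set E} {O P : E} (hPK : P ∈ K) (hPO : P ≠ O)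
    (h : ∀ X ∈ K, 0 ≤ ⟪O - P, X - P⟫) : P ∈ frontier K := by
  refine ⟨subset_closure hPK, fun hint => ?_⟩
  have hlim : Filter.Tendsto (fun t : ℝ => P + t • (P - O)) (nhdsWithin 0 (Set.Ioi 0)) (nhds P) := by
    have : Continuous fun t : ℝ => P + t • (P - O) := by fun_prop
    simpa using (this.tendsto 0).mono_left nhdsWithin_le_nhds
  obtain ⟨t, htK, ht⟩ := ((hlim.eventually (mem_interior_iff_mem_nhds.1 hint)).and
    self_mem_nhdsWithin).exists
  have hle := h _ htK
  rw [add_sub_cancel_left, ← neg_sub P O, inner_neg_left, real_inner_smul_right,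
    real_inner_self_eq_norm_sq] at hle
  have : 0 < t * ‖P - O‖ ^ 2 :=
    mul_pos ht (pow_pos (norm_pos_iff.2 (sub_ne_zero.2 hPO)) 2)
  linarith

end OutwardDeformation


theorem connectivity_radius_ge_least_critical_distance {n : ℕ} (hn : 2 ≤ n)
    (K : Set (EuclideanSpace ℝ (Fin n))) (hK : IsCompact K) (hKc : Convex ℝ K)
    (hdim : 2 ≤ Module.finrank ℝ (vectorSpan ℝ K))
    (O : EuclideanSpace ℝ (Fin n)) (hO : O ∈ frontier K)
    (r : ℝ) (hr : 0 < r)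
    (hdisc : ¬ IsPreconnected (Metric.sphere O r ∩ K)) :
    ∃ P, IsCriticalPoint K O P ∧ dist O P ≤ r := by
  by_contra! hcon
  have hOK : O ∈ K := hK.isClosed.frontier_subset hO
  refine hdisc (isPreconnected_sphere_inter_of_outward hK hKc hdim hOK hr fun P hP hPO hPr => ?_)
  by_contra! hle
  have hnonneg : ∀ X ∈ K, 0 ≤ ⟪O - P, X - P⟫ := fun X hX => by
    rw [← neg_sub P O, inner_neg_left]
    exact neg_nonneg.2 (hle X hX)
  refine (hcon P ⟨mem_frontier_of_forall_inner_nonneg hP hPO hnonneg, hPO, hnonneg⟩).not_ge ?_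
  rwa [dist_comm, dist_eq_norm]
end

section
/- Let K be a closed convex subset of ℝⁿ and let O be a boundary point of K. Then the least critical distance of O is positive: there exists ε > 0 such that every O-critical point P of K satisfies dist(O, P) ≥ ε. -/
open scoped RealInnerProductSpace

/-- A set lies in the slab cut off by the supporting hyperplane at a critical point `P`, written
with the unit vector in the direction of `P - O`. -/
lemma IsCriticalPoint.inner_normalized_le {n : ℕ} {K : Set (EuclideanSpace ℝ (Fin n))}
    {O P X : EuclideanSpace ℝ (Fin n)} (hP : IsCriticalPoint K O P) (hX : X ∈ K) :
    ⟪X - O, ‖P - O‖⁻¹ • (P - O)⟫ ≤ ‖P - O‖ := by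
  have hpos : 0 < ‖P - O‖ := norm_pos_iff.2 (sub_ne_zero.2 hP.2.1)
  have h := hP.2.2 X hX
  rw [← neg_sub P O, inner_neg_left, real_inner_comm,
    show X - P = (X - O) - (P - O) by abel, inner_sub_left, real_inner_self_eq_norm_sq] at h
  rw [inner_smul_right, inv_mul_le_iff₀ hpos]
  nlinarith

theorem least_critical_distance_pos {n : ℕ}
    (K : Set (EuclideanSpace ℝ (Fin n))) (hK : IsClosed K) (hKc : Convex ℝ K)
    (O : EuclideanSpace ℝ (Fin n)) (hO : O ∈ frontier K) :
    ∃ ε > 0, ∀ P, IsCriticalPoint K O P → ε ≤ dist O P := by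
  by_contra! h
  choose P hP hd using fun k : ℕ => h (1 / ((k : ℝ) + 1)) Nat.one_div_pos_of_nat
  have hr : Filter.Tendsto (fun k => ‖P k - O‖) Filter.atTop (nhds 0) := by
    refine squeeze_zero (fun _ => norm_nonneg _) (fun k => ?_) tendsto_one_div_add_atTop_nhds_zero_nat
    rw [← dist_eq_norm, dist_comm]
    exact (hd k).le
  let u : ℕ → EuclideanSpace ℝ (Fin n) := fun k => ‖P k - O‖⁻¹ • (P k - O)
  have hu (k : ℕ) : u k ∈ Metric.sphere (0 : EuclideanSpace ℝ (Fin n)) 1 := by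
    rw [mem_sphere_zero_iff_norm]
    exact norm_smul_inv_norm (𝕜 := ℝ) (sub_ne_zero.2 (hP k).2.1)
  obtain ⟨a, ha, φ, hφ, hlim⟩ := (isCompact_sphere _ _).tendsto_subseq hu
  have hnormal {X : EuclideanSpace ℝ (Fin n)} (hX : X ∈ K) : ⟪X - O, a⟫ ≤ 0 :=
    le_of_tendsto_of_tendsto' (tendsto_const_nhds.inner hlim) (hr.comp hφ.tendsto_atTop)
      fun k => (hP (φ k)).inner_normalized_le hX
  have hself : ⟪a, a⟫ ≤ 0 := by
    refine le_of_tendsto' (hlim.inner tendsto_const_nhds) fun k => ?_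
    simp only [u, Function.comp_apply, real_inner_smul_left]
    exact mul_nonpos_of_nonneg_of_nonpos (inv_nonneg.2 (norm_nonneg _))
      (hnormal (hK.frontier_subset (hP (φ k)).1))
  rw [real_inner_self_eq_norm_sq, mem_sphere_zero_iff_norm.1 ha] at hself
  norm_num at hself
end

section
/- Let O, P₁, P₂ be points in ℝⁿ with P₁ ≠ O and P₂ ≠ O. Suppose ⟪O − P₁, P₂ − P₁⟫ ≥ 0 and ⟪O − P₂, P₁ − P₂⟫ ≥ 0, and that the angle ∠P₁ O P₂ is at most π/3. Then dist(O, P₁) ≤ 2 · dist(O, P₂). -/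
open scoped RealInnerProductSpace
open EuclideanGeometry Real

/-- Vectors at angle at most `π / 3` have inner product at least half the product of their norms. -/
theorem norm_mul_norm_le_two_mul_inner_of_angle_le {V : Type*} [NormedAddCommGroup V]
    [InnerProductSpace ℝ V] {x y : V} (h : InnerProductGeometry.angle x y ≤ π / 3) :
    ‖x‖ * ‖y‖ ≤ 2 * ⟪x, y⟫ := by
  have hcos : 1 / 2 ≤ Real.cos (InnerProductGeometry.angle x y) := by
    rw [← Real.cos_pi_div_three]
    exact Real.cos_le_cos_of_nonneg_of_le_pi (InnerProductGeometry.angle_nonneg x y)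
      (by linarith [Real.pi_pos]) h
  rw [← InnerProductGeometry.cos_angle_mul_norm_mul_norm x y]
  nlinarith [mul_nonneg (norm_nonneg x) (norm_nonneg y)]

theorem dist_le_two_mul_dist_of_critical_pair {n : ℕ}
    (O P₁ P₂ : EuclideanSpace ℝ (Fin n)) (h₁ : P₁ ≠ O) (h₂ : P₂ ≠ O)
    (hc₁ : 0 ≤ ⟪O - P₁, P₂ - P₁⟫) (hc₂ : 0 ≤ ⟪O - P₂, P₁ - P₂⟫)
    (hangle : EuclideanGeometry.angle P₁ O P₂ ≤ π / 3) :
    dist O P₁ ≤ 2 * dist O P₂ := by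
  have hinner : ‖P₁ - O‖ * ‖P₂ - O‖ ≤ 2 * ⟪P₁ - O, P₂ - O⟫ :=
    norm_mul_norm_le_two_mul_inner_of_angle_le hangle
  have hexpand : ⟪O - P₂, P₁ - P₂⟫ = ‖P₂ - O‖ * ‖P₂ - O‖ - ⟪P₁ - O, P₂ - O⟫ := by
    rw [← sub_sub_sub_cancel_right P₁ P₂ O, ← neg_sub P₂ O, inner_neg_left, inner_sub_right,
      real_inner_self_eq_norm_mul_norm, real_inner_comm]
    ring
  rw [dist_comm O P₁, dist_comm O P₂, dist_eq_norm, dist_eq_norm]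
  refine le_of_mul_le_mul_right ?_ (norm_pos_iff.mpr (sub_ne_zero.mpr h₂))
  linarith
end

section
/- Let K ⊆ ℝⁿ be a compact set that is star-shaped with respect to the origin (0 ∈ K and t • x ∈ K for all x ∈ K and t ∈ [0,1]). Let β > 0 and let x, y ∈ K with ‖x‖ = ‖y‖ = β. Suppose that for every s with 0 < s < β, the points (s/β) • x and (s/β) • y lie in the same connected component of the level set K_s = {z ∈ K : ‖z‖ = s}. Then x and y lie in the same connected component of K_β = {z ∈ K : ‖z‖ = β}. -/
open Set

theorem same_component_at_limit_radius {n : ℕ}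
    (K : Set (EuclideanSpace ℝ (Fin n))) (hK : IsCompact K)
    (hstar : (0 : EuclideanSpace ℝ (Fin n)) ∈ K ∧
      ∀ x ∈ K, ∀ t ∈ Icc (0 : ℝ) 1, t • x ∈ K)
    (β : ℝ) (hβ : 0 < β)
    (x y : EuclideanSpace ℝ (Fin n)) (hx : x ∈ K) (hy : y ∈ K)
    (hxn : ‖x‖ = β) (hyn : ‖y‖ = β)
    (hconn : ∀ s : ℝ, 0 < s → s < β →
      ∃ C : Set (EuclideanSpace ℝ (Fin n)),
        C ⊆ {z ∈ K | ‖z‖ = s} ∧ IsPreconnected C ∧ (s / β) • x ∈ C ∧ (s / β) • y ∈ C) :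
    ∃ C : Set (EuclideanSpace ℝ (Fin n)),
      C ⊆ {z ∈ K | ‖z‖ = β} ∧ IsPreconnected C ∧ x ∈ C ∧ y ∈ C := by
  have hS : IsCompact {z ∈ K | ‖z‖ = β} :=
    hK.inter_right (isClosed_eq continuous_norm continuous_const)
  have : CompactSpace {z ∈ K | ‖z‖ = β} := isCompact_iff_compactSpace.mp hS
  let x' : {z ∈ K | ‖z‖ = β} := ⟨x, hx, hxn⟩
  let y' : {z ∈ K | ‖z‖ = β} := ⟨y, hy, hyn⟩
  refine ⟨Subtype.val '' connectedComponent x', ?_,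
    isPreconnected_connectedComponent.image _ continuous_subtype_val.continuousOn,
    ⟨x', mem_connectedComponent, rfl⟩, ⟨y', ?_, rfl⟩⟩
  · rintro _ ⟨z, -, rfl⟩
    exact z.2
  rw [connectedComponent_eq_iInter_isClopen]
  refine mem_iInter.2 fun ⟨A, hA, hxA⟩ => ?_
  by_contra hyA
  have hdisj : Disjoint (Subtype.val '' A) (Subtype.val '' Aᶜ) :=
    (disjoint_image_iff Subtype.val_injective).2 disjoint_compl_right
  obtain ⟨U, V, hU, hV, hAU, hAV, hUV⟩ := SeparatedNhds.of_isCompact_isCompact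
    (hA.isClosed.isCompact.image continuous_subtype_val)
    (hA.compl.isClosed.isCompact.image continuous_subtype_val) hdisj
  have hcover : ∀ z ∈ K, ‖z‖ = β → z ∈ U ∪ V := fun z hz hzn => by
    by_cases h : (⟨z, hz, hzn⟩ : {z ∈ K | ‖z‖ = β}) ∈ A
    · exact Or.inl (hAU ⟨_, h, rfl⟩)
    · exact Or.inr (hAV ⟨_, h, rfl⟩)
  -- The rescaled level sets near radius `β` are also covered by `U ∪ V`.
  have hev : ∀ᶠ t in nhds (1 : ℝ),
      ∀ z ∈ Metric.sphere (0 : EuclideanSpace ℝ (Fin n)) β \ (U ∪ V), t • z ∉ K := by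
    refine ((isCompact_sphere _ _).diff (hU.union hV)).eventually_forall_of_forall_eventually
      fun z hz => ?_
    have hzK : (1 : ℝ) • z ∉ K := by
      rw [one_smul]
      exact fun h => hz.2 (hcover z h (mem_sphere_zero_iff_norm.1 hz.1))
    have hcont : Continuous fun p : ℝ × EuclideanSpace ℝ (Fin n) => p.1 • p.2 := by fun_prop
    exact (hK.isClosed.isOpen_compl.preimage hcont).mem_nhds hzK
  obtain ⟨t, ht, ht0, ht1⟩ := ((hev.filter_mono nhdsWithin_le_nhds).and
    (Ioo_mem_nhdsLT (zero_lt_one' ℝ))).exists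
  obtain ⟨C, hC, hCconn, hxC, hyC⟩ := hconn (t * β) (by positivity) (by nlinarith)
  rw [mul_div_cancel_right₀ _ hβ.ne'] at hxC hyC
  have hD : IsPreconnected ((fun z => t⁻¹ • z) '' C) :=
    hCconn.image _ (continuous_const_smul _).continuousOn
  have hDsub : (fun z => t⁻¹ • z) '' C ⊆ U ∪ V := by
    rintro _ ⟨z, hz, rfl⟩
    by_contra hzUV
    refine ht (t⁻¹ • z) ⟨?_, hzUV⟩ ?_
    · rw [mem_sphere_zero_iff_norm, norm_smul, (hC hz).2, norm_inv, Real.norm_of_nonneg ht0.le,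
        inv_mul_cancel_left₀ ht0.ne']
    · rw [smul_inv_smul₀ ht0.ne']
      exact (hC hz).1
  have hxD : x ∈ (fun z => t⁻¹ • z) '' C := ⟨_, hxC, inv_smul_smul₀ ht0.ne' x⟩
  have hyD : y ∈ (fun z => t⁻¹ • z) '' C := ⟨_, hyC, inv_smul_smul₀ ht0.ne' y⟩
  obtain ⟨z, -, hzU, hzV⟩ := hD U V hU hV hDsub
    ⟨x, hxD, hAU ⟨x', hxA, rfl⟩⟩ ⟨y, hyD, hAV ⟨y', hyA, rfl⟩⟩
  exact hUV.le_bot ⟨hzU, hzV⟩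
end

section
/- Let K be a convex subset of ℝⁿ whose affine span has dimension at least 2, and let O be any point. Then K \ {O} is path-connected. -/
theorem exists_mem_notMem_line_of_two_le_finrank_vectorSpan {V : Type*} [AddCommGroup V]
    [Module ℝ V] {K : Set V} (hdim : 2 ≤ Module.finrank ℝ (vectorSpan ℝ K)) (p q : V) :
    ∃ z ∈ K, z ∉ line[ℝ, p, q] := by
  by_contra! h
  have hle : vectorSpan ℝ K ≤ vectorSpan ℝ {p, q} := by
    rw [← direction_affineSpan, ← direction_affineSpan]
    exact AffineSubspace.direction_le (affineSpan_le.2 h)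
  have := (collinear_pair ℝ p q).finiteDimensional_vectorSpan
  have := Submodule.finrank_mono hle
  have := (collinear_iff_finrank_le_one (k := ℝ)).1 (collinear_pair ℝ p q)
  omega

theorem Convex.joinedIn_diff_singleton {V : Type*} [AddCommGroup V] [Module ℝ V]
    [TopologicalSpace V] [ContinuousAdd V] [ContinuousSMul ℝ V] {K : Set V}
    (hK : Convex ℝ K) {o x y : V} (hx : x ∈ K) (hy : y ∈ K) (ho : o ∉ segment ℝ x y) :
    JoinedIn (K \ {o}) x y :=
  JoinedIn.of_segment_subset fun _ hw =>
    ⟨hK.segment_subset hx hy hw, fun h => ho (h ▸ hw)⟩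

theorem convex_diff_singleton_isPathConnected {n : ℕ}
    (K : Set (EuclideanSpace ℝ (Fin n))) (hKc : Convex ℝ K)
    (hdim : 2 ≤ Module.finrank ℝ (vectorSpan ℝ K))
    (O : EuclideanSpace ℝ (Fin n)) :
    IsPathConnected (K \ {O}) := by
  have hline := exists_mem_notMem_line_of_two_le_finrank_vectorSpan hdim
  rw [isPathConnected_iff]
  constructor
  · obtain ⟨z, hz, hzO⟩ := hline O O
    exact ⟨z, hz, fun h => hzO (h ▸ left_mem_affineSpan_pair ℝ O O)⟩
  · rintro x ⟨hx, hxO : x ≠ O⟩ y ⟨hy, hyO : y ≠ O⟩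
    by_cases hO : O ∈ segment ℝ x y
    · obtain ⟨z, hz, hzl⟩ := hline x O
      have hyl : y ∈ line[ℝ, x, O] :=
        (mem_segment_iff_wbtw.1 hO).right_mem_affineSpan_of_left_ne hxO
      refine (hKc.joinedIn_diff_singleton hx hz fun h => hzl ?_).trans
        (hKc.joinedIn_diff_singleton hz hy fun h => hzl ?_)
      · exact (mem_segment_iff_wbtw.1 h).right_mem_affineSpan_of_left_ne hxO
      · exact affineSpan_pair_le_of_mem_of_mem hyl (right_mem_affineSpan_pair ℝ x O)
          ((mem_segment_iff_wbtw.1 h).left_mem_affineSpan_of_right_ne hyO)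
    · exact hKc.joinedIn_diff_singleton hx hy hO
end

section
/- Let K be a compact convex subset of ℝⁿ whose affine span has dimension at least 2, and let O be a boundary point of K. Then the connectivity radius of O is positive: there exists ε > 0 such that for every r with 0 < r < ε, the set Metric.sphere O r ∩ K is connected (preconnected). -/
/-- Two vectors are joined at radius `r` when their radial projections to the sphere of radius `r`
lie in a common preconnected subset of the part of `K` on that sphere. -/
def RadiallyJoined {E : Type*} [NormedAddCommGroup E] [InnerProductSpace ℝ E]
    (K : Set E) (r : ℝ) (a b : E) : Prop :=
  ∃ t ⊆ Metric.sphere (0 : E) r ∩ K,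
    (r / ‖a‖) • a ∈ t ∧ (r / ‖b‖) • b ∈ t ∧ IsPreconnected t

section

open Filter Topology

variable {E : Type*} [NormedAddCommGroup E] [InnerProductSpace ℝ E] {K : Set E}

theorem RadiallyJoined.trans {r : ℝ} {a b c : E} (hab : RadiallyJoined K r a b)
    (hbc : RadiallyJoined K r b c) : RadiallyJoined K r a c := by
  obtain ⟨t, ht, hat, hbt, htc⟩ := hab
  obtain ⟨u, hu, hbu, hcu, huc⟩ := hbc
  exact ⟨t ∪ u, Set.union_subset ht hu, Or.inl hat, Or.inr hcu, htc.union _ hbt hbu huc⟩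

theorem RadiallyJoined.of_segment (hK : Convex ℝ K) (h0 : (0 : E) ∈ K) {r : ℝ} (hr : 0 < r)
    {a b : E} (ha : a ∈ K) (hb : b ∈ K) (h : ∀ z ∈ segment ℝ a b, r ≤ ‖z‖) :
    RadiallyJoined K r a b := by
  refine ⟨(fun z : E => (r / ‖z‖) • z) '' segment ℝ a b, ?_,
    ⟨a, left_mem_segment ℝ a b, rfl⟩, ⟨b, right_mem_segment ℝ a b, rfl⟩, ?_⟩
  · rintro _ ⟨z, hz, rfl⟩
    have hz' := h z hz
    have hpos : 0 < ‖z‖ := hr.trans_le hz'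
    refine ⟨?_, ?_⟩
    · rw [mem_sphere_zero_iff_norm, norm_smul, Real.norm_of_nonneg (by positivity)]
      field_simp
    · exact hK.smul_mem_of_zero_mem h0 (hK.segment_subset ha hb hz)
        ⟨by positivity, (div_le_one hpos).2 hz'⟩
  · refine (convex_segment a b).isPreconnected.image _ ?_
    refine ContinuousOn.smul (continuousOn_const.div continuous_norm.continuousOn ?_)
      continuousOn_id
    intro z hz
    exact (hr.trans_le (h z hz)).ne'

theorem RadiallyJoined.eventually_of_zero_notMem_segment (hK : Convex ℝ K) (h0 : (0 : E) ∈ K)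
    {a b : E} (ha : a ∈ K) (hb : b ∈ K) (h : (0 : E) ∉ segment ℝ a b) :
    ∀ᶠ r : ℝ in 𝓝 0, 0 < r → RadiallyJoined K r a b := by
  have hc : IsCompact (segment ℝ a b) := by
    rw [segment_eq_image_lineMap]
    exact isCompact_Icc.image AffineMap.lineMap_continuous
  obtain ⟨m, hm, hmin⟩ := hc.exists_isMinOn ⟨a, left_mem_segment ℝ a b⟩
    continuous_norm.continuousOn
  have hm0 : 0 < ‖m‖ := norm_pos_iff.2 fun h' => h (h' ▸ hm)
  filter_upwards [gt_mem_nhds hm0] with r hrm hr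
  exact .of_segment hK h0 hr ha hb fun z hz => hrm.le.trans (hmin hz)

theorem mem_span_singleton_of_zero_mem_segment {a b : E} (ha : a ≠ 0)
    (h : (0 : E) ∈ segment ℝ a b) : b ∈ Submodule.span ℝ {a} := by
  obtain ⟨s, t, -, -, hst, h⟩ := h
  have ht : t ≠ 0 := by
    rintro rfl
    simp_all
  refine Submodule.mem_span_singleton.2 ⟨-(t⁻¹ * s), ?_⟩
  have : b = t⁻¹ • (t • b) := by rw [smul_smul, inv_mul_cancel₀ ht, one_smul]
  rw [this, eq_neg_of_add_eq_zero_right h, smul_neg, smul_smul, neg_smul]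

theorem RadiallyJoined.eventually (hK : Convex ℝ K) (h0 : (0 : E) ∈ K)
    (hspan : ∀ v : E, ∃ s ∈ K, s ∉ Submodule.span ℝ {v}) {a b : E} (ha : a ∈ K) (hb : b ∈ K)
    (ha0 : a ≠ 0) (hb0 : b ≠ 0) :
    ∀ᶠ r : ℝ in 𝓝 0, 0 < r → RadiallyJoined K r a b := by
  by_cases h : (0 : E) ∈ segment ℝ a b
  · obtain ⟨s, hs, hsa⟩ := hspan a
    have hba := mem_span_singleton_of_zero_mem_segment ha0 h
    have h1 : (0 : E) ∉ segment ℝ a s := fun h' =>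
      hsa (mem_span_singleton_of_zero_mem_segment ha0 h')
    have h2 : (0 : E) ∉ segment ℝ s b := fun h' =>
      hsa ((Submodule.span_singleton_le_iff_mem _ _).2 hba
        (mem_span_singleton_of_zero_mem_segment hb0 (segment_symm ℝ s b ▸ h')))
    filter_upwards [eventually_of_zero_notMem_segment hK h0 ha hs h1,
      eventually_of_zero_notMem_segment hK h0 hs hb h2] with r hr1 hr2 hr
    exact (hr1 hr).trans (hr2 hr)
  · exact eventually_of_zero_notMem_segment hK h0 ha hb h

theorem RadiallyJoined.of_sq_le_inner (hK : Convex ℝ K) (h0 : (0 : E) ∈ K) {r : ℝ} (hr : 0 < r)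
    {x p : E} (hx : x ∈ K) (hp : p ∈ K) (hxr : ‖x‖ = r) (h : r ^ 2 ≤ inner ℝ x p) :
    RadiallyJoined K r x p := by
  refine .of_segment hK h0 hr hx hp ?_
  rintro _ ⟨s, t, hs, ht, hst, rfl⟩
  have h1 : r ^ 2 ≤ inner ℝ x (s • x + t • p) := by
    rw [inner_add_right, inner_smul_right, inner_smul_right, real_inner_self_eq_norm_sq, hxr]
    have := mul_le_mul_of_nonneg_left h ht
    have hs' : s = 1 - t := by linarith
    subst hs'
    linarith
  have h2 := h1.trans (real_inner_le_norm x _)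
  rw [hxr, sq] at h2
  exact le_of_mul_le_mul_left h2 hr

theorem eventually_isPreconnected_sphere_inter [FiniteDimensional ℝ E] (hK : Convex ℝ K)
    (h0 : (0 : E) ∈ K) (hspan : ∀ v : E, ∃ s ∈ K, s ∉ Submodule.span ℝ {v}) :
    ∀ᶠ r : ℝ in 𝓝 0, 0 < r → IsPreconnected (Metric.sphere (0 : E) r ∩ K) := by
  obtain ⟨q, hq, hq0⟩ : ∃ q ∈ K, q ≠ 0 := by
    obtain ⟨q, hq, hq'⟩ := hspan 0
    exact ⟨q, hq, by
      rintro rfl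
      exact hq' (Submodule.zero_mem _)⟩
  have key : ∀ᶠ r : ℝ in 𝓝 0, ∀ u ∈ Metric.sphere (0 : E) 1,
      0 < r → ‖u‖ = 1 → r • u ∈ K → RadiallyJoined K r (r • u) q := by
    refine (isCompact_sphere (0 : E) 1).eventually_forall_of_forall_eventually fun u hu => ?_
    by_cases h : ∃ p ∈ K, 0 < inner ℝ u p
    · obtain ⟨p, hp, hup⟩ := h
      have hp0 : p ≠ 0 := by
        rintro rfl
        simp at hup
      have e1 : ∀ᶠ z : ℝ × E in 𝓝 (0, u), z.1 < inner ℝ z.2 p :=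
        (isOpen_lt continuous_fst (by fun_prop)).mem_nhds hup
      have e2 : ∀ᶠ z : ℝ × E in 𝓝 (0, u), 0 < z.1 → RadiallyJoined K z.1 p q :=
        (continuous_fst.tendsto ((0 : ℝ), u)).eventually
          (RadiallyJoined.eventually hK h0 hspan hp hq hp0 hq0)
      filter_upwards [e1, e2] with z h1 h2 hr hz hzK
      refine (RadiallyJoined.of_sq_le_inner hK h0 hr hzK hp ?_ ?_).trans (h2 hr)
      · rw [norm_smul, hz, mul_one, Real.norm_of_nonneg hr.le]
      · rw [real_inner_smul_left, sq]
        exact mul_le_mul_of_nonneg_left h1.le hr.le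
    · push Not at h
      have hu1 : ‖u‖ = 1 := mem_sphere_zero_iff_norm.1 hu
      have e1 : ∀ᶠ z : ℝ × E in 𝓝 (0, u), 0 < inner ℝ u z.2 := by
        refine (isOpen_lt continuous_const (by fun_prop)).mem_nhds ?_
        simp [hu1]
      filter_upwards [e1] with z h1 hr _ hzK
      have h2 := h _ hzK
      rw [real_inner_smul_right] at h2
      exact absurd h2 (mul_pos hr h1).not_ge
  have hqn : 0 < ‖q‖ := norm_pos_iff.2 hq0
  filter_upwards [key] with r hr hr0
  refine isPreconnected_of_forall ((r / ‖q‖) • q) fun x ⟨hxr, hxK⟩ => ?_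
  rw [mem_sphere_zero_iff_norm] at hxr
  have hu : ‖r⁻¹ • x‖ = 1 := by
    rw [norm_smul, hxr, Real.norm_of_nonneg (by positivity), inv_mul_cancel₀ hr0.ne']
  have hrx : r • r⁻¹ • x = x := smul_inv_smul₀ hr0.ne' x
  obtain ⟨t, ht, hxt, hqt, htc⟩ :=
    hr _ (mem_sphere_zero_iff_norm.2 hu) hr0 hu (hrx.symm ▸ hxK)
  rw [hrx, hxr, div_self hr0.ne', one_smul] at hxt
  exact ⟨t, ht, hqt, hxt, htc⟩

end

theorem connectivity_radius_pos {n : ℕ}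
    (K : Set (EuclideanSpace ℝ (Fin n))) (hK : IsCompact K) (hKc : Convex ℝ K)
    (hdim : 2 ≤ Module.finrank ℝ (vectorSpan ℝ K))
    (O : EuclideanSpace ℝ (Fin n)) (hO : O ∈ frontier K) :
    ∃ ε > 0, ∀ r : ℝ, 0 < r → r < ε → IsPreconnected (Metric.sphere O r ∩ K) := by
  have hOK : O ∈ K := hK.isClosed.frontier_subset hO
  have hspan : ∀ v, ∃ s ∈ (fun z => O + z) ⁻¹' K, s ∉ Submodule.span ℝ {v} := by
    intro v
    by_contra! h
    have hle : vectorSpan ℝ K ≤ Submodule.span ℝ {v} := by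
      rw [vectorSpan_eq_span_vsub_set_right ℝ hOK, Submodule.span_le]
      rintro _ ⟨z, hz, rfl⟩
      exact h _ (by simpa using hz)
    have h1 := Submodule.finrank_mono hle
    have h2 := finrank_span_le_card (R := ℝ) {v}
    rw [Set.toFinset_singleton, Finset.card_singleton] at h2
    omega
  have hev := eventually_isPreconnected_sphere_inter (hKc.translate_preimage_right O)
    (by simpa using hOK) hspan
  obtain ⟨ε, hε, h⟩ := Metric.eventually_nhds_iff.1 hev
  refine ⟨ε, hε, fun r hr hrε => ?_⟩
  have himage := (h (by rwa [Real.dist_eq, sub_zero, abs_of_pos hr]) hr).image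
    (fun z => O + z) (by fun_prop)
  convert himage using 1
  rw [Set.image_inter_preimage]
  simp
end

section
/- Let A, B, C be affinely independent points in ℝ² forming an acute-angled triangle, let K be the convex hull of {A, B, C}, let F be the orthogonal projection of A onto the line through B and C, and let h = dist(A, F) be the altitude length from A. Then: (1) for every r with 0 < r < h, the set Metric.sphere A r ∩ K is connected (preconnected); and (2) for every r with h < r < min(dist(A,B), dist(A,C)), the set Metric.sphere A r ∩ K is not connected (not preconnected). In particular, the connectivity radius of A equals the length of the altitude from A. -/
open EuclideanGeometry Real

section Triangle

variable {V : Type*} [NormedAddCommGroup V] [InnerProductSpace ℝ V]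

theorem mem_convexHull_triple_iff_exists_smul (A B C X : V) :
    X ∈ convexHull ℝ {A, B, C} ↔ ∃ s ∈ Set.Icc (0 : ℝ) 1, ∃ t ∈ Set.Icc (0 : ℝ) 1,
      X = A + s • (B + t • (C - B) - A) := by
  rw [convexHull_insert ⟨B, by simp⟩, convexHull_pair, mem_convexJoin]
  constructor
  · rintro ⟨a, rfl, p, hp, hX⟩
    rw [segment_eq_image'] at hp hX
    obtain ⟨t, ht, rfl⟩ := hp
    obtain ⟨s, hs, rfl⟩ := hX
    exact ⟨s, hs, t, ht, rfl⟩
  · rintro ⟨s, hs, t, ht, rfl⟩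
    refine ⟨A, rfl, B + t • (C - B), ?_, ?_⟩
    · rw [segment_eq_image']
      exact ⟨t, ht, rfl⟩
    · rw [segment_eq_image']
      exact ⟨s, hs, rfl⟩

/-- A circle about a vertex of a triangle that does not reach the opposite side meets the triangle
in a connected arc, the radial projection of that side. -/
theorem isPreconnected_sphere_inter_triangle {A B C : V} {r : ℝ} (hr : 0 < r)
    (hside : ∀ t : ℝ, r ≤ ‖B + t • (C - B) - A‖) :
    IsPreconnected (Metric.sphere A r ∩ convexHull ℝ {A, B, C}) := by
  have hpos : ∀ t : ℝ, 0 < ‖B + t • (C - B) - A‖ := fun t => hr.trans_le (hside t)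
  have himage : Metric.sphere A r ∩ convexHull ℝ {A, B, C} =
      (fun t : ℝ => A + (r / ‖B + t • (C - B) - A‖) • (B + t • (C - B) - A)) ''
        Set.Icc 0 1 := by
    ext X
    rw [Set.mem_inter_iff, mem_convexHull_triple_iff_exists_smul, mem_sphere_iff_norm]
    constructor
    · rintro ⟨hX, s, hs, t, ht, rfl⟩
      refine ⟨t, ht, ?_⟩
      rw [add_sub_cancel_left, norm_smul, Real.norm_of_nonneg hs.1] at hX
      simp only [← hX, mul_div_assoc, div_self (hpos t).ne', mul_one]
    · rintro ⟨t, ht, rfl⟩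
      refine ⟨?_, _, ⟨by positivity, (div_le_one (hpos t)).2 (hside t)⟩, t, ht, rfl⟩
      rw [add_sub_cancel_left, norm_smul, Real.norm_of_nonneg (by positivity),
        div_mul_cancel₀ _ (hpos t).ne']
  rw [himage]
  refine isPreconnected_Icc.image _ (Continuous.continuousOn ?_)
  have hne : ∀ t : ℝ, ‖B + t • (C - B) - A‖ ≠ 0 := fun t => (hpos t).ne'
  fun_prop (disch := assumption)

/-- A circle about `A` that crosses the segments `AB` and `AC` meets the triangle in points on both
sides of the altitude from `A`; if it misses the altitude, the intersection is disconnected. -/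
theorem not_isPreconnected_sphere_inter_triangle {A B C : V} {r : ℝ} (hr : 0 < r)
    (hB : inner ℝ (C - B) (B - A) < 0) (hC : 0 < inner ℝ (C - B) (C - A))
    (hrB : r ≤ ‖B - A‖) (hrC : r ≤ ‖C - A‖)
    (hfoot : ∀ t : ℝ, inner ℝ (C - B) (B + t • (C - B) - A) = 0 → ‖B + t • (C - B) - A‖ < r) :
    ¬ IsPreconnected (Metric.sphere A r ∩ convexHull ℝ {A, B, C}) := by
  intro hconn
  have hmem : ∀ t ∈ Set.Icc (0 : ℝ) 1, r ≤ ‖B + t • (C - B) - A‖ →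
      A + (r / ‖B + t • (C - B) - A‖) • (B + t • (C - B) - A) ∈
        Metric.sphere A r ∩ convexHull ℝ {A, B, C} := by
    intro t ht hle
    have hpos := hr.trans_le hle
    refine ⟨?_, (mem_convexHull_triple_iff_exists_smul ..).2
      ⟨_, ⟨by positivity, (div_le_one hpos).2 hle⟩, t, ht, rfl⟩⟩
    rw [mem_sphere_iff_norm, add_sub_cancel_left, norm_smul, Real.norm_of_nonneg (by positivity),
      div_mul_cancel₀ _ hpos.ne']
  have hB' := hmem 0 (by simp) (by simpa using hrB)
  have hC' := hmem 1 (by simp) (by simpa using hrC)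
  simp only [zero_smul, add_zero, one_smul, add_sub_cancel] at hB' hC'
  obtain ⟨X, ⟨hXr, hXK⟩, hX⟩ := hconn.intermediate_value hB' hC'
    (f := fun X => inner ℝ (C - B) (X - A)) (by fun_prop) (show (0 : ℝ) ∈ Set.Icc _ _ by
      simp only [add_sub_cancel_left, inner_smul_right]
      exact ⟨mul_nonpos_of_nonneg_of_nonpos (by positivity) hB.le,
        mul_nonneg (by positivity) hC.le⟩)
  obtain ⟨s, hs, t, -, rfl⟩ := (mem_convexHull_triple_iff_exists_smul ..).1 hXK
  rw [mem_sphere_iff_norm, add_sub_cancel_left, norm_smul, Real.norm_of_nonneg hs.1] at hXr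
  simp only [add_sub_cancel_left, inner_smul_right] at hX
  rcases mul_eq_zero.1 hX with rfl | hinner
  · simp [hr.ne] at hXr
  · exact absurd (hfoot t hinner) (not_lt.2 (hXr ▸ mul_le_of_le_one_left (norm_nonneg _) hs.2))

end Triangle

theorem connectivity_radius_of_acute_triangle_eq_altitude
    (A B C : EuclideanSpace ℝ (Fin 2)) (hind : AffineIndependent ℝ ![A, B, C])
    (hA : ∠ B A C < π / 2) (hB : ∠ A B C < π / 2) (hC : ∠ B C A < π / 2)
    (K : Set (EuclideanSpace ℝ (Fin 2))) (hK : K = convexHull ℝ {A, B, C})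
    (F : EuclideanSpace ℝ (Fin 2))
    (hF : F = (EuclideanGeometry.orthogonalProjection (affineSpan ℝ {B, C}) A :
      EuclideanSpace ℝ (Fin 2)))
    (h : ℝ) (hh : h = dist A F) :
    (∀ r : ℝ, 0 < r → r < h → IsPreconnected (Metric.sphere A r ∩ K)) ∧
    (∀ r : ℝ, h < r → r < min (dist A B) (dist A C) →
      ¬ IsPreconnected (Metric.sphere A r ∩ K)) := by
  have hdist (P) (hP : P ∈ affineSpan ℝ {B, C}) :
      ‖P - A‖ * ‖P - A‖ = ‖P - F‖ * ‖P - F‖ + h * h := by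
    have := EuclideanGeometry.dist_sq_eq_dist_orthogonalProjection_sq_add_dist_orthogonalProjection_sq
      A hP
    rwa [← hF, dist_eq_norm P A, dist_eq_norm P F, ← hh] at this
  have hline (t : ℝ) : B + t • (C - B) ∈ affineSpan ℝ {B, C} := by
    simpa [AffineMap.lineMap_apply, add_comm] using AffineMap.lineMap_mem_affineSpan_pair t B C
  have hFmem : F ∈ affineSpan ℝ {B, C} := hF ▸ EuclideanGeometry.orthogonalProjection_mem A
  have hdir : C - B ∈ (affineSpan ℝ {B, C}).direction :=
    AffineSubspace.vsub_mem_direction (right_mem_affineSpan_pair ℝ B C)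
      (left_mem_affineSpan_pair ℝ B C)
  have horth : inner ℝ (C - B) (F - A) = 0 := by
    rw [hF]
    exact EuclideanGeometry.orthogonalProjection_vsub_mem_direction_orthogonal _ A _ hdir
  have hh0 : 0 ≤ h := hh ▸ dist_nonneg
  subst hK
  refine ⟨fun r hr hrh => isPreconnected_sphere_inter_triangle hr fun t => ?_,
    fun r hrh hrmin => ?_⟩
  · refine hrh.le.trans (abs_le_of_sq_le_sq' ?_ (norm_nonneg _)).2
    nlinarith [hdist _ (hline t), mul_self_nonneg ‖B + t • (C - B) - F‖]
  · rw [lt_min_iff, dist_comm A B, dist_comm A C, dist_eq_norm, dist_eq_norm] at hrmin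
    rw [EuclideanGeometry.angle, InnerProductGeometry.angle, Real.arccos_lt_pi_div_two] at hB hC
    have hB' : 0 < inner ℝ (A - B) (C - B) := by
      by_contra! hle
      exact hB.not_ge (div_nonpos_of_nonpos_of_nonneg hle (by positivity))
    have hC' : 0 < inner ℝ (B - C) (A - C) := by
      by_contra! hle
      exact hC.not_ge (div_nonpos_of_nonpos_of_nonneg hle (by positivity))
    refine not_isPreconnected_sphere_inter_triangle (hh0.trans_lt hrh) ?_ ?_ hrmin.1.le hrmin.2.le
      fun t ht => ?_
    · rwa [← neg_sub A B, inner_neg_right, neg_lt_zero, real_inner_comm]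
    · rwa [← neg_sub A C, ← neg_sub B C, inner_neg_neg]
    · obtain ⟨u, hu⟩ := mem_affineSpan_pair_iff_exists_lineMap_eq.1 hFmem
      have hCB : C - B ≠ 0 := by
        intro h0
        simp [h0] at hB'
      have hFu : F = B + u • (C - B) := by
        rw [← hu, AffineMap.lineMap_apply, vsub_eq_sub, vadd_eq_add, add_comm]
      have htu : t = u := by
        rw [hFu] at horth
        have hsub : inner ℝ (C - B) ((t - u) • (C - B)) = 0 := by
          rw [← sub_eq_zero.2 (ht.trans horth.symm), ← inner_sub_right]
          congr 1
          module
        rw [inner_smul_right, mul_eq_zero, inner_self_eq_zero] at hsub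
        exact sub_eq_zero.1 (hsub.resolve_right hCB)
      rwa [htu, ← hFu, ← dist_eq_norm, dist_comm, ← hh]
end

section
/- Let K ⊆ ℝⁿ be a compact convex set, let O ∈ frontier K, let r > 0, and suppose the level set L = Metric.sphere O r ∩ K is nonempty and contains no O-critical point. Then there exists a smooth vector field V : ℝⁿ → ℝⁿ (ContDiff ℝ ⊤ V) such that for every p ∈ L: (1) ⟪V p, p − O⟫ = 1 (constant positive radial component), and (2) there exists δ > 0 such that p + t • V p ∈ K for all t ∈ [0, δ] (V points into K). -/
open scoped RealInnerProductSpace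
open Set

open scoped Topology Manifold ContDiff

/-- The vectors along which one can move inside a convex set for a short time, starting at a given
point, form a convex set. -/
theorem convex_setOf_pointing_into {E : Type*} [AddCommGroup E] [Module ℝ E] {K : Set E}
    (hK : Convex ℝ K) (p : E) :
    Convex ℝ {w : E | ∃ δ > (0 : ℝ), ∀ t ∈ Icc (0 : ℝ) δ, p + t • w ∈ K} := by
  rintro v ⟨δ, hδ, hv⟩ w ⟨ε, hε, hw⟩ a b ha hb hab
  refine ⟨min δ ε, lt_min hδ hε, fun t ht => ?_⟩
  have hcomb := hK (hv t ⟨ht.1, ht.2.trans (min_le_left _ _)⟩)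
    (hw t ⟨ht.1, ht.2.trans (min_le_right _ _)⟩) ha hb hab
  convert hcomb using 1
  obtain rfl : b = 1 - a := by linarith
  module

/-- A positive multiple of a vector from a point of a convex set to another point of that set
points into the set. -/
theorem Convex.exists_add_smul_smul_sub_mem {E : Type*} [AddCommGroup E] [Module ℝ E] {K : Set E}
    (hK : Convex ℝ K) {p x : E} (hp : p ∈ K) (hx : x ∈ K) {c : ℝ} (hc : 0 < c) :
    ∃ δ > (0 : ℝ), ∀ t ∈ Icc (0 : ℝ) δ, p + t • c • (x - p) ∈ K := by
  refine ⟨c⁻¹, inv_pos.2 hc, fun t ht => ?_⟩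
  rw [smul_smul]
  refine hK.add_smul_sub_mem hp hx ⟨mul_nonneg ht.1 hc.le, ?_⟩
  calc t * c ≤ c⁻¹ * c := mul_le_mul_of_nonneg_right ht.2 hc.le
    _ = 1 := inv_mul_cancel₀ hc.ne'

/-- If a point of `K` other than `O` is not `O`-critical, then some point of `K` lies strictly
beyond it in the radial direction from `O`. -/
theorem exists_inner_sub_pos_of_not_isCriticalPoint {n : ℕ}
    {K : Set (EuclideanSpace ℝ (Fin n))} {O P : EuclideanSpace ℝ (Fin n)} (hP : P ∈ K)
    (hPO : P ≠ O) (hnc : ¬ IsCriticalPoint K O P) : ∃ X ∈ K, 0 < ⟪X - P, P - O⟫ := by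
  by_cases hfr : P ∈ frontier K
  · by_contra! h
    refine hnc ⟨hfr, hPO, fun X hX => ?_⟩
    have := h X hX
    rw [← neg_sub P O, inner_neg_left, real_inner_comm]
    linarith
  · have hint : K ∈ 𝓝 P := mem_interior_iff_mem_nhds.1 <| by
      by_contra h
      exact hfr ⟨subset_closure hP, h⟩
    have htend : Filter.Tendsto (fun t : ℝ => P + t • (P - O)) (𝓝[>] 0) (𝓝 P) := by
      have : Continuous fun t : ℝ => P + t • (P - O) := by fun_prop
      simpa using (this.tendsto 0).mono_left nhdsWithin_le_nhds
    obtain ⟨t, htK, ht⟩ := ((htend.eventually hint).and self_mem_nhdsWithin).exists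
    refine ⟨_, htK, ?_⟩
    rw [add_sub_cancel_left, real_inner_smul_left]
    exact mul_pos ht (real_inner_self_pos.2 (sub_ne_zero.2 hPO))

theorem exists_smooth_vector_field_on_noncritical_level {n : ℕ}
    (K : Set (EuclideanSpace ℝ (Fin n))) (hK : IsCompact K) (hKc : Convex ℝ K)
    (O : EuclideanSpace ℝ (Fin n)) (hO : O ∈ frontier K)
    (r : ℝ) (hr : 0 < r)
    (L : Set (EuclideanSpace ℝ (Fin n))) (hL : L = Metric.sphere O r ∩ K)
    (hne : L.Nonempty) (hnc : ∀ P ∈ L, ¬ IsCriticalPoint K O P) :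
    ∃ V : EuclideanSpace ℝ (Fin n) → EuclideanSpace ℝ (Fin n),
      ContDiff ℝ (⊤ : ℕ∞) V ∧
      ∀ p ∈ L, ⟪V p, p - O⟫ = 1 ∧
        ∃ δ > 0, ∀ t ∈ Icc (0 : ℝ) δ, p + t • V p ∈ K := by
  let t : EuclideanSpace ℝ (Fin n) → Set (EuclideanSpace ℝ (Fin n)) := fun p =>
    {w | p ∈ L → ⟪w, p - O⟫ = 1 ∧ ∃ δ > (0 : ℝ), ∀ s ∈ Icc (0 : ℝ) δ, p + s • w ∈ K}
  have hconv : ∀ p, Convex ℝ (t p) := by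
    intro p v hv w hw a b ha hb hab hp
    refine ⟨?_, convex_setOf_pointing_into hKc p (hv hp).2 (hw hp).2 ha hb hab⟩
    rw [inner_add_left, real_inner_smul_left, real_inner_smul_left, (hv hp).1, (hw hp).1]
    linarith
  have hLclosed : IsClosed L := hL ▸ Metric.isClosed_sphere.inter hK.isClosed
  have hloc : ∀ p, ∃ U ∈ 𝓝 p, ∃ g : EuclideanSpace ℝ (Fin n) → EuclideanSpace ℝ (Fin n),
      CMDiff[U] ∞ g ∧ ∀ q ∈ U, g q ∈ t q := by
    intro p
    by_cases hp : p ∈ L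
    · have hp' : p ∈ Metric.sphere O r ∩ K := hL ▸ hp
      obtain ⟨X, hX, hpos⟩ := exists_inner_sub_pos_of_not_isCriticalPoint hp'.2
        (Metric.ne_of_mem_sphere hp'.1 hr.ne') (hnc p hp)
      have hcont : Continuous fun q : EuclideanSpace ℝ (Fin n) => ⟪X - q, q - O⟫ := by fun_prop
      refine ⟨{q | 0 < ⟪X - q, q - O⟫}, (isOpen_lt continuous_const hcont).mem_nhds hpos,
        fun q => ⟪X - q, q - O⟫⁻¹ • (X - q), ?_, fun q hq hqL => ⟨?_, ?_⟩⟩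
      · have hinner : ContDiff ℝ ∞ fun q : EuclideanSpace ℝ (Fin n) => ⟪X - q, q - O⟫ :=
          (contDiff_const.sub contDiff_id).inner ℝ (contDiff_id.sub contDiff_const)
        exact ((hinner.contDiffOn.inv fun q hq => ne_of_gt hq).smul
          (contDiff_const.sub contDiff_id).contDiffOn).contMDiffOn
      · rw [real_inner_smul_left]
        exact inv_mul_cancel₀ (ne_of_gt hq)
      · rw [hL] at hqL
        exact hKc.exists_add_smul_smul_sub_mem hqL.2 hX (inv_pos.2 hq)
    · exact ⟨Lᶜ, hLclosed.isOpen_compl.mem_nhds hp, fun _ => 0, contMDiffOn_const,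
        fun q hq hqL => absurd hqL hq⟩
  obtain ⟨V, hV⟩ := exists_contMDiffMap_forall_mem_convex_of_local
    (𝓘(ℝ, EuclideanSpace ℝ (Fin n))) hconv hloc
  exact ⟨V, V.contMDiff.contDiff, fun p hp => hV p hp⟩
end
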